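/- arXiv:math/0607410 — 2 statements merged into one kernel-verified Lean document; each statement's English description precedes it below -/
import Mathlib

section
/- Selberg's integral formula for integer exponent: Let n ≥ 1 and k ≥ 1 be integers and let a, b > 0 be real numbers. Then ∫_{[0,1]^n} Δ(x)^{2k} ∏_{i=1}^n x_i^{a−1}(1−x_i)^{b−1} dx₁⋯dx_n = ∏_{j=0}^{n−1} Γ(a+jk)·Γ(b+jk)·Γ((j+1)k+1) / (Γ(a+b+(n+j−1)k)·Γ(k+1)). -/
open MeasureTheory

/-- The Vandermonde product `Δ(x) = ∏_{i<j} (x_j - x_i)`. -/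
def vandermonde {n : ℕ} (x : Fin n → ℝ) : ℝ :=
  ∏ p ∈ Finset.univ.filter (fun p : Fin n × Fin n => p.1 < p.2), (x p.2 - x p.1)

/-- Selberg's integral `𝒮ₙ(a,b;k)` for integer exponent `k`. -/
noncomputable def selberg (n k : ℕ) (a b : ℝ) : ℝ :=
  ∫ x : Fin n → ℝ in Set.univ.pi (fun _ => Set.Icc (0:ℝ) 1),
    vandermonde x ^ (2 * k) * ∏ i, x i ^ (a - 1) * (1 - x i) ^ (b - 1)

/-- The product of a symmetric function over ordered pairs of distinct indices is the square of
its product over increasing pairs. -/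
@[to_additive]
theorem prod_offDiag_eq_prod_filter_lt_sq {ι M : Type*} [Fintype ι] [LinearOrder ι] [CommMonoid M]
    (f : ι → ι → M) (hf : ∀ i j, f i j = f j i) :
    ∏ i, ∏ j, (if i = j then 1 else f i j) =
      (∏ p ∈ Finset.univ.filter (fun p : ι × ι => p.1 < p.2), f p.1 p.2) ^ 2 := by
  have h1 : ∀ p : ι × ι, (if p.1 = p.2 then 1 else f p.1 p.2) =
      (if p.1 < p.2 then f p.1 p.2 else 1) * (if p.2 < p.1 then f p.2 p.1 else 1) := by
    intro p
    rcases lt_trichotomy p.1 p.2 with h | h | h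
    · simp [h, h.ne, h.le.not_gt]
    · simp [h]
    · simp [h, h.ne', h.le.not_gt, hf p.1 p.2]
  rw [← Fintype.prod_prod_type', Finset.prod_congr rfl (fun p _ => h1 p), Finset.prod_mul_distrib,
    Finset.prod_filter, sq]
  congr 1
  exact Fintype.prod_equiv (Equiv.prodComm ι ι) _ _ (fun _ => rfl)

theorem vandermonde_pow_two_mul {n : ℕ} (x : Fin n → ℝ) (k : ℕ) :
    vandermonde x ^ (2 * k) = (∏ i, ∏ j, if i = j then 1 else |x j - x i|) ^ k := by
  rw [prod_offDiag_eq_prod_filter_lt_sq (fun i j => |x j - x i|) (fun i j => abs_sub_comm _ _),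
    pow_mul, ← Finset.abs_prod, sq_abs, vandermonde]

theorem vandermonde_insertNth_one_pow {n : ℕ} (i : Fin (n + 1)) (y : Fin n → ℝ) (k : ℕ) :
    vandermonde (i.insertNth (1 : ℝ) y : Fin (n + 1) → ℝ) ^ (2 * k) =
      vandermonde y ^ (2 * k) * ∏ l, (1 - y l) ^ (2 * k) := by
  have h : ∀ l, |y l - 1| * |1 - y l| = (1 - y l) ^ 2 := fun l => by
    rw [abs_sub_comm, ← sq, sq_abs]
  rw [vandermonde_pow_two_mul, vandermonde_pow_two_mul, Fin.prod_univ_succAbove _ i]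
  simp_rw [Fin.prod_univ_succAbove _ i]
  simp only [Fin.insertNth_apply_same, Fin.insertNth_apply_succAbove, Fin.succAbove_right_inj,
    if_true, one_mul, Fin.succAbove_ne, (Fin.succAbove_ne _ _).symm, if_false]
  rw [Finset.prod_mul_distrib, ← mul_assoc, ← Finset.prod_mul_distrib, Finset.prod_congr rfl
    (fun l _ => h l), mul_pow, mul_comm]
  simp_rw [pow_mul, Finset.prod_pow]

theorem selberg_comm (n k : ℕ) (a b : ℝ) : selberg n k a b = selberg n k b a := by
  have hs : MeasurableSet (Set.univ.pi (fun _ : Fin n => Set.Icc (0:ℝ) 1)) :=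
    MeasurableSet.univ_pi fun _ => measurableSet_Icc
  rw [selberg, selberg, ← integral_indicator hs, ← integral_indicator hs,
    ← integral_sub_left_eq_self _ volume (1 : Fin n → ℝ)]
  congr 1
  ext x
  have hx : (1 - x) ∈ Set.univ.pi (fun _ : Fin n => Set.Icc (0:ℝ) 1) ↔
      x ∈ Set.univ.pi (fun _ : Fin n => Set.Icc (0:ℝ) 1) := by
    simp only [Set.mem_univ_pi, Set.mem_Icc, Pi.sub_apply, Pi.one_apply]
    refine forall_congr' fun i => ⟨fun h => ?_, fun h => ?_⟩ <;> constructor <;> linarith [h.1, h.2]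
  by_cases h : x ∈ Set.univ.pi (fun _ : Fin n => Set.Icc (0:ℝ) 1)
  · rw [Set.indicator_of_mem h, Set.indicator_of_mem (hx.2 h), vandermonde_pow_two_mul,
      vandermonde_pow_two_mul]
    simp only [Pi.sub_apply, Pi.one_apply, sub_sub_sub_cancel_left, sub_sub_cancel]
    congr 1
    · refine congrArg (· ^ k) (Finset.prod_congr rfl fun i _ => Finset.prod_congr rfl fun j _ => ?_)
      rw [abs_sub_comm]
    · exact Finset.prod_congr rfl fun i _ => mul_comm _ _
  · rw [Set.indicator_of_notMem h, Set.indicator_of_notMem (mt hx.1 h)]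

theorem integrableOn_and_integral_beta {a b : ℝ} (ha : 0 < a) (hb : 0 < b) :
    IntegrableOn (fun x : ℝ => x ^ (a - 1) * (1 - x) ^ (b - 1)) (Set.Icc 0 1) ∧
      ∫ x in Set.Icc (0:ℝ) 1, x ^ (a - 1) * (1 - x) ^ (b - 1) = ProbabilityTheory.beta a b := by
  have hc := Complex.betaIntegral_convergent (u := a) (v := b) (by simpa) (by simpa)
  have heq : ∀ x ∈ Set.Icc (0:ℝ) 1, ((x : ℂ) ^ ((a : ℂ) - 1) * (1 - (x : ℂ)) ^ ((b : ℂ) - 1)) =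
      ((x ^ (a - 1) * (1 - x) ^ (b - 1) : ℝ) : ℂ) := by
    intro x hx
    rw [Complex.ofReal_mul, Complex.ofReal_cpow hx.1, Complex.ofReal_cpow (sub_nonneg.2 hx.2)]
    push_cast
    rfl
  rw [intervalIntegrable_iff_integrableOn_Icc_of_le zero_le_one] at hc
  have hc' := (hc.congr_fun heq measurableSet_Icc)
  refine ⟨by simpa [IntegrableOn] using hc'.re, ?_⟩
  rw [ProbabilityTheory.beta_eq_betaIntegralReal a b ha hb, Complex.betaIntegral,
    intervalIntegral.integral_of_le zero_le_one, ← integral_Icc_eq_integral_Ioc,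
    setIntegral_congr_fun measurableSet_Icc heq, integral_complex_ofReal, Complex.ofReal_re]

/-- Integral of a polynomial against a product of beta weights over the unit cube. -/
theorem setIntegral_eval_mul_prod_beta {n : ℕ} (p : MvPolynomial (Fin n) ℝ) {a b : ℝ}
    (ha : 0 < a) (hb : 0 < b) :
    ∫ x : Fin n → ℝ in Set.univ.pi (fun _ => Set.Icc (0:ℝ) 1),
      MvPolynomial.eval x p * ∏ i, x i ^ (a - 1) * (1 - x i) ^ (b - 1) =
    ∑ α ∈ p.support, p.coeff α * ∏ i, ProbabilityTheory.beta (a + α i) b := by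
  have hpos : ∀ m : ℕ, 0 < a + m := fun m => by positivity
  have hae : ∀ m : ℕ, (fun x : ℝ => x ^ (a + m - 1) * (1 - x) ^ (b - 1))
      =ᵐ[volume.restrict (Set.Icc 0 1)]
      (fun x : ℝ => x ^ m * (x ^ (a - 1) * (1 - x) ^ (b - 1))) := by
    intro m
    rw [← restrict_Ioo_eq_restrict_Icc]
    filter_upwards [ae_restrict_mem measurableSet_Ioo] with x hx
    rw [← mul_assoc, ← Real.rpow_natCast, ← Real.rpow_add hx.1]
    ring_nf
  have hint : ∀ m : ℕ, Integrable (fun x : ℝ => x ^ m * (x ^ (a - 1) * (1 - x) ^ (b - 1)))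
      (volume.restrict (Set.Icc 0 1)) := fun m =>
    ((integrableOn_and_integral_beta (hpos m) hb).1).congr (hae m)
  have hval : ∀ m : ℕ, ∫ x in Set.Icc (0:ℝ) 1, x ^ m * (x ^ (a - 1) * (1 - x) ^ (b - 1)) =
      ProbabilityTheory.beta (a + m) b := fun m => by
    rw [← (integrableOn_and_integral_beta (hpos m) hb).2]
    exact (integral_congr_ae (hae m)).symm
  rw [volume_pi, Measure.restrict_pi_pi]
  simp_rw [MvPolynomial.eval_eq', Finset.sum_mul, mul_assoc, ← Finset.prod_mul_distrib]
  rw [integral_finsetSum]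
  · refine Finset.sum_congr rfl fun α _ => ?_
    rw [integral_const_mul]
    congr 1
    rw [integral_fintype_prod_eq_prod (𝕜 := ℝ)
      (f := fun i (t : ℝ) => t ^ α i * (t ^ (a - 1) * (1 - t) ^ (b - 1)))]
    exact Finset.prod_congr rfl fun i _ => hval (α i)
  · intro α _
    exact (Integrable.fintype_prod (𝕜 := ℝ)
      (f := fun i (t : ℝ) => t ^ α i * (t ^ (a - 1) * (1 - t) ^ (b - 1)))
      fun i => hint (α i)).const_mul _

/-- The Vandermonde product as a polynomial. -/
noncomputable def vandermondePoly (n : ℕ) : MvPolynomial (Fin n) ℝ :=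
  ∏ p ∈ Finset.univ.filter (fun p : Fin n × Fin n => p.1 < p.2),
    (MvPolynomial.X p.2 - MvPolynomial.X p.1)

theorem eval_vandermondePoly {n : ℕ} (x : Fin n → ℝ) :
    MvPolynomial.eval x (vandermondePoly n) = vandermonde x := by
  simp [vandermondePoly, vandermonde, map_prod]

theorem selberg_eq_sum (n k : ℕ) {a b : ℝ} (ha : 0 < a) (hb : 0 < b) :
    selberg n k a b = ∑ α ∈ (vandermondePoly n ^ (2 * k)).support,
      (vandermondePoly n ^ (2 * k)).coeff α * ∏ i, ProbabilityTheory.beta (a + α i) b := by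
  rw [← setIntegral_eval_mul_prod_beta _ ha hb]
  simp_rw [map_pow, eval_vandermondePoly]
  rfl

/-- Lower bounds for the partial degree in the variables from `T` add up in a product. -/
theorem sum_le_sum_of_mem_support_prod {ι σ R : Type*} [CommSemiring R] (T : Finset σ)
    (s : Finset ι) (f : ι → MvPolynomial σ R) (d : ι → ℕ)
    (h : ∀ i ∈ s, ∀ α ∈ (f i).support, d i ≤ ∑ j ∈ T, α j) :
    ∀ α ∈ (∏ i ∈ s, f i).support, ∑ i ∈ s, d i ≤ ∑ j ∈ T, α j := by
  classical
  induction s using Finset.induction_on with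
  | empty => simp
  | insert i s hi ih =>
    intro α hα
    rw [Finset.prod_insert hi] at hα
    obtain ⟨β, hβ, γ, hγ, rfl⟩ := Finset.mem_add.1 (MvPolynomial.support_mul _ _ hα)
    rw [Finset.sum_insert hi]
    simp only [Finsupp.add_apply, Finset.sum_add_distrib]
    exact add_le_add (h i (Finset.mem_insert_self _ _) β hβ)
      (ih (fun j hj => h j (Finset.mem_insert_of_mem hj)) γ hγ)

theorem two_mul_sum_filter_lt_mem {n : ℕ} (T : Finset (Fin n)) :
    2 * ∑ p ∈ Finset.univ.filter (fun p : Fin n × Fin n => p.1 < p.2),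
      (if p.1 ∈ T ∧ p.2 ∈ T then 1 else 0) + T.card = T.card * T.card := by
  have h := sum_offDiag_eq_sum_filter_lt_sq (M := ℕ)
    (fun i j : Fin n => if i ∈ T ∧ j ∈ T then 1 else 0) (fun i j => by simp [and_comm])
  rw [← smul_eq_mul, ← h]
  have h1 : ∀ i j : Fin n, (if i = j then 0 else if i ∈ T ∧ j ∈ T then 1 else 0) +
      (if i = j then (if i ∈ T then 1 else 0) else 0) =
      (if i ∈ T then 1 else 0) * (if j ∈ T then 1 else 0) := by
    intro i j
    by_cases hij : i = j
    · subst hij; simp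
    · by_cases hi : i ∈ T <;> simp [hij, hi]
  have h2 : T.card = ∑ i : Fin n, ∑ j : Fin n, if i = j then (if i ∈ T then 1 else 0) else 0 := by
    simp
  conv_lhs => rw [h2]
  simp_rw [← Finset.sum_add_distrib, h1, ← Finset.mul_sum, ← Finset.sum_mul]
  simp

theorem sum_mem_support_vandermondePoly_pow {n k : ℕ} {α : Fin n →₀ ℕ}
    (hα : α ∈ (vandermondePoly n ^ (2 * k)).support) (T : Finset (Fin n)) :
    k * (T.card * T.card) ≤ ∑ i ∈ T, α i + k * T.card := by
  have hX : ∀ p ∈ Finset.univ.filter (fun p : Fin n × Fin n => p.1 < p.2),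
      ∀ α ∈ (MvPolynomial.X p.2 - MvPolynomial.X p.1 : MvPolynomial (Fin n) ℝ).support,
      (if p.1 ∈ T ∧ p.2 ∈ T then 1 else 0) ≤ ∑ j ∈ T, α j := by
    intro p _ α hα
    split_ifs with h
    · have := MvPolynomial.support_sub _ _ _ hα
      rw [Finset.mem_union, MvPolynomial.support_X, MvPolynomial.support_X,
        Finset.mem_singleton, Finset.mem_singleton] at this
      rcases this with rfl | rfl <;> simp [Finsupp.single_apply, h]
    · exact Nat.zero_le _
  rw [← Finset.card_range (2 * k), ← Finset.prod_const] at hα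
  have := sum_le_sum_of_mem_support_prod T _ _ _
    (fun _ _ => sum_le_sum_of_mem_support_prod T _ _ _ hX) α hα
  rw [Finset.sum_const, Finset.card_range, smul_eq_mul] at this
  rw [← two_mul_sum_filter_lt_mem T]
  linarith

theorem sum_eq_of_mem_support_vandermondePoly_pow {n k : ℕ} {α : Fin n →₀ ℕ}
    (hα : α ∈ (vandermondePoly n ^ (2 * k)).support) :
    ∑ i, α i + k * n = k * (n * n) := by
  have h : (vandermondePoly n ^ (2 * k)).IsHomogeneous
      ((∑ p ∈ Finset.univ.filter (fun p : Fin n × Fin n => p.1 < p.2), 1) * (2 * k)) :=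
    (MvPolynomial.IsHomogeneous.prod _ _ _ fun p _ =>
      (MvPolynomial.isHomogeneous_X ℝ p.2).sub (MvPolynomial.isHomogeneous_X ℝ p.1)).pow _
  have h1 := h (MvPolynomial.mem_support_iff.1 hα)
  have h2 := two_mul_sum_filter_lt_mem (Finset.univ : Finset (Fin n))
  rw [Pi.one_def, ← Finsupp.degree_eq_weight_one, Finsupp.degree_eq_sum] at h1
  simp only [Finset.mem_univ, and_self, if_true, Finset.card_univ, Fintype.card_fin] at h2
  rw [h1, ← h2]
  ring

theorem sort_bounds_of_mem_support {m k : ℕ} {α : Fin (m + 1) →₀ ℕ}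
    (hα : α ∈ (vandermondePoly (m + 1) ^ (2 * k)).support) (j : Fin (m + 1)) :
    j * k ≤ α (Tuple.sort α j) ∧ α (Tuple.sort α j) ≤ (m + j) * k := by
  set σ := Tuple.sort α
  have hmono : Monotone (fun i => α (σ i)) := Tuple.monotone_sort α
  have hsum : ∀ s : Finset (Fin (m + 1)), k * (s.card * s.card) ≤ ∑ i ∈ s, α (σ i) + k * s.card := by
    intro s
    simpa using sum_mem_support_vandermondePoly_pow hα (s.map σ.toEmbedding)
  have htot := sum_eq_of_mem_support_vandermondePoly_pow hα
  rw [← Equiv.sum_comp σ, ← Finset.sum_add_sum_compl (Finset.Iio j)] at htot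
  constructor
  · have h1 := hsum (Finset.Iic j)
    have h2 := Finset.sum_le_card_nsmul (Finset.Iic j) (fun i => α (σ i)) (α (σ j))
      (fun i hi => hmono (Finset.mem_Iic.1 hi))
    rw [Fin.card_Iic] at h1 h2
    rw [smul_eq_mul] at h2
    have h3 : ((j : ℕ) + 1) * (j * k) ≤ ((j : ℕ) + 1) * α (σ j) := by nlinarith
    exact Nat.le_of_mul_le_mul_left h3 (Nat.succ_pos _)
  · have h1 := hsum (Finset.Iio j)
    have h2 := Finset.card_nsmul_le_sum (Finset.Iio j)ᶜ (fun i => α (σ i)) (α (σ j))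
      (fun i hi => hmono (by simpa using hi))
    rw [Finset.card_compl, Fin.card_Iio, Fintype.card_fin, smul_eq_mul] at h2
    rw [Fin.card_Iio] at h1
    obtain ⟨d, hd⟩ : ∃ d, m = j + d := ⟨m - j, by omega⟩
    have h4 : m + 1 - j = d + 1 := by omega
    rw [h4] at h2
    have h3 : (d + 1) * α (σ j) ≤ (d + 1) * ((m + j) * k) := by
      have hm : (m : ℤ) = j + d := by exact_mod_cast hd
      zify at htot h1 h2 ⊢
      rw [hm] at htot ⊢
      nlinarith
    exact Nat.le_of_mul_le_mul_left h3 (Nat.succ_pos _)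

theorem Gamma_add_natCast {x : ℝ} (hx : 0 < x) (m : ℕ) :
    Real.Gamma (x + m) = Real.Gamma x * (ascPochhammer ℝ m).eval x := by
  induction m with
  | zero => simp
  | succ m ih =>
    rw [ascPochhammer_succ_eval, ← mul_assoc, ← ih, Nat.cast_succ, ← add_assoc,
      Real.Gamma_add_one (by positivity), mul_comm]

theorem beta_add_natCast {a b : ℝ} (ha : 0 < a) (hb : 0 < b) {l α u : ℕ} (hl : l ≤ α)
    (hu : α ≤ u) :
    ProbabilityTheory.beta (a + α) b = Real.Gamma b * Real.Gamma (a + l) / Real.Gamma (a + b + u) *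
      ((ascPochhammer ℝ (α - l)).eval (a + l) * (ascPochhammer ℝ (u - α)).eval (a + b + α)) := by
  have h1 : a + α = a + l + (α - l : ℕ) := by rw [Nat.cast_sub hl]; ring
  have h2 : a + b + u = a + b + α + (u - α : ℕ) := by rw [Nat.cast_sub hu]; ring
  have h3 : a + α + b = a + b + α := by ring
  have h4 := (Real.Gamma_pos_of_pos (show 0 < a + b + α by positivity)).ne'
  have h5 := (ascPochhammer_pos (u - α) (a + b + α) (by positivity)).ne'
  rw [ProbabilityTheory.beta, h3, h2, h1, Gamma_add_natCast (show 0 < a + l by positivity),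
    Gamma_add_natCast (show 0 < a + b + α by positivity)]
  field_simp

open Polynomial in
theorem exists_polynomial_slices_selberg (m k : ℕ) : ∃ P : ℝ → ℝ → ℝ,
    (∀ a, ∃ q : ℝ[X], q.natDegree ≤ ∑ j : Fin (m + 1), (j : ℕ) * k ∧ ∀ b, q.eval b = P a b) ∧
    (∀ b, ∃ r : ℝ[X], ∀ a, r.eval a = P a b) ∧
    ∀ a b, 0 < a → 0 < b → selberg (m + 1) k a b =
      (∏ j : Fin (m + 1), Real.Gamma b * Real.Gamma (a + (j * k : ℕ)) /
        Real.Gamma (a + b + ((m + j) * k : ℕ))) * P a b := by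
  let F := vandermondePoly (m + 1) ^ (2 * k)
  let s : (Fin (m + 1) →₀ ℕ) → Fin (m + 1) → ℕ := fun α j => α (Tuple.sort α j)
  refine ⟨fun a b => ∑ α ∈ F.support, F.coeff α * ∏ j : Fin (m + 1),
    ((ascPochhammer ℝ (s α j - j * k)).eval (a + (j * k : ℕ)) *
      (ascPochhammer ℝ ((m + j) * k - s α j)).eval (a + b + s α j)), fun a => ?_, fun b => ?_,
    fun a b ha hb => ?_⟩
  · refine ⟨∑ α ∈ F.support, C (F.coeff α) * ∏ j : Fin (m + 1),
      (C ((ascPochhammer ℝ (s α j - j * k)).eval (a + (j * k : ℕ))) *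
      (ascPochhammer ℝ ((m + j) * k - s α j)).comp (X + C (a + s α j))), ?_, fun b => ?_⟩
    · refine natDegree_sum_le_of_forall_le _ _ fun α hα => ?_
      refine (natDegree_C_mul_le _ _).trans ((natDegree_prod_le _ _).trans ?_)
      have hdeg : ∑ j : Fin (m + 1), ((m + j) * k - s α j) ≤ ∑ j : Fin (m + 1), (j : ℕ) * k := by
        have h1 : ∑ j : Fin (m + 1), ((m + j) * k - s α j) + ∑ j, s α j =
            (m + 1) * (m * k) + ∑ j : Fin (m + 1), (j : ℕ) * k := by
          rw [← Finset.sum_add_distrib, Finset.sum_congr rfl fun j _ =>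
            Nat.sub_add_cancel (sort_bounds_of_mem_support hα j).2]
          simp [add_mul, Finset.sum_add_distrib]
        have h2 : ∑ j, s α j = ∑ j, α j := Equiv.sum_comp (Tuple.sort α) α
        have h3 := sum_eq_of_mem_support_vandermondePoly_pow hα
        nlinarith
      refine (Finset.sum_le_sum fun j _ => (natDegree_C_mul_le _ _).trans ?_).trans hdeg
      rw [natDegree_comp, natDegree_X_add_C, ascPochhammer_natDegree, mul_one]
    · simp only [eval_finsetSum, eval_mul, eval_C, eval_prod, eval_comp, eval_add, eval_X]
      simp only [add_left_comm b, add_assoc]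
  · refine ⟨∑ α ∈ F.support, C (F.coeff α) * ∏ j : Fin (m + 1),
      ((ascPochhammer ℝ (s α j - j * k)).comp (X + C ((j * k : ℕ) : ℝ)) *
      (ascPochhammer ℝ ((m + j) * k - s α j)).comp (X + C (b + s α j))), fun a => ?_⟩
    simp only [eval_finsetSum, eval_mul, eval_C, eval_prod, eval_comp, eval_add, eval_X, add_assoc]
  · rw [selberg_eq_sum _ _ ha hb, Finset.mul_sum]
    refine Finset.sum_congr rfl fun α hα => ?_
    rw [mul_left_comm, ← Finset.prod_mul_distrib, ← Equiv.prod_comp (Tuple.sort α)]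
    refine congrArg _ (Finset.prod_congr rfl fun j _ => ?_)
    exact beta_add_natCast ha hb (sort_bounds_of_mem_support hα j).1
      (sort_bounds_of_mem_support hα j).2

open Polynomial in
theorem eq_const_mul_of_polynomial_slices {P : ℝ → ℝ → ℝ} {A : ℝ[X]}
    (hA : ∀ a, 0 < a → 0 < A.eval a)
    (hq : ∀ a, ∃ q : ℝ[X], q.natDegree ≤ A.natDegree ∧ ∀ b, q.eval b = P a b)
    (hr : ∀ b, ∃ r : ℝ[X], ∀ a, r.eval a = P a b)
    (hP : ∀ a b, 0 < a → 0 < b → P a b * A.eval a = P b a * A.eval b) :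
    ∃ c, ∀ a b, 0 < a → 0 < b → P a b = c * A.eval b := by
  have hA0 : A ≠ 0 := fun h => by simpa [h] using hA 1 one_pos
  have key : ∀ a b, 0 < a → P b a = P 1 a := by
    intro a b ha
    obtain ⟨q, hqd, hq⟩ := hq a
    obtain ⟨r, hr⟩ := hr a
    have heq : q * C (A.eval a) = r * A := by
      refine eq_of_infinite_eval_eq _ _ ((Set.Ioi_infinite (0 : ℝ)).mono fun b hb => ?_)
      simp only [Set.mem_ofPred_eq, eval_mul, eval_C, hq, hr]
      exact hP a b ha hb
    have hr0 : r.natDegree = 0 := by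
      rcases eq_or_ne r 0 with rfl | hne
      · simp
      · have h1 := natDegree_mul hne hA0
        rw [← heq] at h1
        have h2 := natDegree_mul_C_le q (A.eval a)
        omega
    rw [← hr, ← hr, eq_C_of_natDegree_eq_zero hr0, eval_C, eval_C]
  refine ⟨P 1 1 / A.eval 1, fun a b ha hb => ?_⟩
  have h1 := hP 1 b one_pos hb
  rw [key 1 b one_pos] at h1
  have := (hA 1 one_pos).ne'
  rw [key b a hb]
  field_simp
  exact h1

/-- Selberg's formula up to a constant that does not depend on `a` and `b`. -/
theorem exists_const_selberg (m k : ℕ) : ∃ c : ℝ, ∀ a b, 0 < a → 0 < b →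
    selberg (m + 1) k a b = c * ∏ j : Fin (m + 1), (Real.Gamma (a + (j * k : ℕ)) *
      Real.Gamma (b + (j * k : ℕ)) / Real.Gamma (a + b + ((m + j) * k : ℕ))) := by
  obtain ⟨P, hq, hr, hS⟩ := exists_polynomial_slices_selberg m k
  let A : Polynomial ℝ := ∏ j : Fin (m + 1), ascPochhammer ℝ (j * k)
  have hAe : ∀ a, A.eval a = ∏ j : Fin (m + 1), (ascPochhammer ℝ (j * k)).eval a := fun a =>
    Polynomial.eval_prod _ _ _
  have hA : ∀ a, 0 < a → 0 < A.eval a := fun a ha => by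
    rw [hAe]
    exact Finset.prod_pos fun j _ => ascPochhammer_pos _ _ ha
  have hAd : A.natDegree = ∑ j : Fin (m + 1), (j : ℕ) * k := by
    rw [Polynomial.natDegree_prod_of_monic _ _ fun j _ => monic_ascPochhammer ℝ _]
    simp only [ascPochhammer_natDegree]
  rw [← hAd] at hq
  have hS' : ∀ a b, 0 < a → 0 < b → selberg (m + 1) k a b = (∏ j : Fin (m + 1), Real.Gamma a *
      Real.Gamma b / Real.Gamma (a + b + ((m + j) * k : ℕ))) * (P a b * A.eval a) := by
    intro a b ha hb
    rw [hS a b ha hb, hAe, mul_left_comm, mul_comm (P a b), ← Finset.prod_mul_distrib]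
    refine congrArg (· * _) (Finset.prod_congr rfl fun j _ => ?_)
    rw [Gamma_add_natCast ha]
    ring
  obtain ⟨c, hc⟩ := eq_const_mul_of_polynomial_slices hA hq hr (fun a b ha hb => by
    have h1 := hS' a b ha hb
    rw [selberg_comm, hS' b a hb ha] at h1
    simp only [add_comm b a, mul_comm (Real.Gamma b)] at h1
    refine (mul_left_cancel₀ (Finset.prod_ne_zero_iff.2 fun j _ => ?_) h1).symm
    have := Real.Gamma_pos_of_pos ha
    have := Real.Gamma_pos_of_pos hb
    have := Real.Gamma_pos_of_pos (show 0 < a + b + ((m + j) * k : ℕ) by positivity)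
    positivity)
  refine ⟨c, fun a b ha hb => ?_⟩
  rw [hS a b ha hb, hc a b ha hb, hAe, mul_left_comm, ← Finset.prod_mul_distrib]
  refine congrArg _ (Finset.prod_congr rfl fun j _ => ?_)
  rw [Gamma_add_natCast hb]
  ring

theorem beta_one_right {x : ℝ} (hx : 0 < x) : ProbabilityTheory.beta x 1 = 1 / x := by
  have := (Real.Gamma_pos_of_pos hx).ne'
  rw [ProbabilityTheory.beta, Real.Gamma_one, Real.Gamma_add_one hx.ne']
  field_simp

/-- Integrating out the largest variable. -/
theorem selberg_one_one_succ (m k : ℕ) :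
    (1 + (m * k : ℕ)) * selberg (m + 1) k 1 1 = selberg m k 1 (1 + (2 * k : ℕ)) := by
  set F := vandermondePoly (m + 1) ^ (2 * k) with hF
  have hface : ∀ i : Fin (m + 1), selberg m k 1 (1 + (2 * k : ℕ)) =
      ∑ α ∈ F.support, F.coeff α * ∏ l, (1 / (1 + α (i.succAbove l) : ℝ)) := by
    intro i
    calc selberg m k 1 (1 + (2 * k : ℕ))
        = ∫ y : Fin m → ℝ in Set.univ.pi (fun _ => Set.Icc (0:ℝ) 1),
          ∑ α ∈ F.support, F.coeff α * ∏ l, y l ^ α (i.succAbove l) := by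
          rw [selberg]
          congr 1
          ext y
          have := MvPolynomial.eval_eq' (i.insertNth (1 : ℝ) y : Fin (m + 1) → ℝ) F
          simp only [Fin.prod_univ_succAbove _ i, Fin.insertNth_apply_same,
            Fin.insertNth_apply_succAbove, one_pow, one_mul] at this
          rw [← this, hF, map_pow, eval_vandermondePoly, vandermonde_insertNth_one_pow]
          simp only [sub_self, Real.rpow_zero, one_mul, add_sub_cancel_left, Real.rpow_natCast]
      _ = _ := by
          have hI : ∀ d : ℕ, ∫ t in Set.Icc (0:ℝ) 1, t ^ d = 1 / (1 + d : ℝ) := fun d => by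
            rw [integral_Icc_eq_integral_Ioc, ← intervalIntegral.integral_of_le zero_le_one,
              integral_pow]
            simp [add_comm]
          have hc : ∀ d : ℕ, Integrable (fun t : ℝ => t ^ d) (volume.restrict (Set.Icc 0 1)) :=
            fun d => (continuous_pow d).integrableOn_Icc
          rw [volume_pi, Measure.restrict_pi_pi, integral_finsetSum]
          · refine Finset.sum_congr rfl fun α _ => ?_
            rw [integral_const_mul, integral_fintype_prod_eq_prod (𝕜 := ℝ)
              (f := fun l (t : ℝ) => t ^ α (i.succAbove l))]
            simp only [hI]
          · intro α _
            exact (Integrable.fintype_prod (𝕜 := ℝ)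
              (f := fun l (t : ℝ) => t ^ α (i.succAbove l)) fun l => hc _).const_mul _
  have hsum : ∀ α ∈ F.support, ∑ i : Fin (m + 1), ∏ l, (1 / (1 + α (i.succAbove l) : ℝ)) =
      (m + 1) * (1 + (m * k : ℕ)) * ∏ i, (1 / (1 + α i : ℝ)) := by
    intro α hα
    have h1 : ∀ i : Fin (m + 1), ∏ l, (1 / (1 + α (i.succAbove l) : ℝ)) =
        (1 + α i) * ∏ i, (1 / (1 + α i : ℝ)) := by
      intro i
      have : (1 + α i : ℝ) ≠ 0 := by positivity
      rw [Fin.prod_univ_succAbove (fun i => (1 / (1 + α i : ℝ))) i, ← mul_assoc,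
        mul_one_div_cancel this, one_mul]
    have h2 := sum_eq_of_mem_support_vandermondePoly_pow hα
    have h3 : (∑ i, (α i : ℝ)) + k * (m + 1) = k * ((m + 1) * (m + 1)) := by exact_mod_cast h2
    simp_rw [h1, ← Finset.sum_mul]
    congr 1
    rw [Finset.sum_add_distrib]
    simp only [Finset.sum_const, Finset.card_univ, Fintype.card_fin, nsmul_eq_mul]
    push_cast
    linarith
  have htotal : ((m : ℝ) + 1) * ((1 + (m * k : ℕ)) * selberg (m + 1) k 1 1) =
      (m + 1) * selberg m k 1 (1 + (2 * k : ℕ)) := by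
    calc _ = ∑ α ∈ F.support, F.coeff α * ((m + 1) * (1 + (m * k : ℕ)) *
          ∏ i, (1 / (1 + α i : ℝ))) := by
          rw [selberg_eq_sum _ _ one_pos one_pos, ← mul_assoc, Finset.mul_sum]
          refine Finset.sum_congr rfl fun α _ => ?_
          rw [Finset.prod_congr rfl fun i _ => beta_one_right (show (0 : ℝ) < 1 + α i by positivity)]
          ring
      _ = ∑ i : Fin (m + 1), ∑ α ∈ F.support,
          F.coeff α * ∏ l, (1 / (1 + α (i.succAbove l) : ℝ)) := by
          rw [Finset.sum_comm]
          refine Finset.sum_congr rfl fun α hα => ?_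
          rw [← Finset.mul_sum, hsum α hα]
      _ = _ := by
          rw [← Finset.sum_congr rfl fun i _ => hface i]
          simp
  exact mul_left_cancel₀ (by positivity) htotal

/-- The recursion for the constant in Selberg's formula, solved for the constant. -/
theorem eq_prod_of_mul_prod_eq {g D : ℕ → ℝ} {c t : ℝ} {m : ℕ} (hg : ∀ i, g i ≠ 0)
    (hD : ∀ i, D i ≠ 0) (hg0 : g 0 = 1) (ht : D m = t * g m)
    (h : t * (c * ∏ j ∈ Finset.range (m + 1), g j * g j / D (m + j)) =
      ∏ j ∈ Finset.range m, g j * g (j + 2) * g (j + 1) / (D (m + 1 + j) * g 1)) :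
    c = ∏ j ∈ Finset.range (m + 1), g (j + 1) / g 1 := by
  have hA : ∏ j ∈ Finset.range m, g j ≠ 0 := Finset.prod_ne_zero_iff.2 fun _ _ => hg _
  have hB : ∏ j ∈ Finset.range m, g (j + 1) ≠ 0 := Finset.prod_ne_zero_iff.2 fun _ _ => hg _
  have hE : ∏ j ∈ Finset.range m, D (m + 1 + j) ≠ 0 := Finset.prod_ne_zero_iff.2 fun _ _ => hD _
  have ht0 : t ≠ 0 := fun h0 => hD m (by rw [ht, h0, zero_mul])
  have h1 : ∏ j ∈ Finset.range (m + 1), D (m + j) =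
      (∏ j ∈ Finset.range m, D (m + 1 + j)) * (t * g m) := by
    rw [Finset.prod_range_succ', add_zero, ht]
    simp only [add_assoc, add_comm 1]
  have h2 : ∏ j ∈ Finset.range (m + 1), g j * g j =
      ((∏ j ∈ Finset.range m, g j) * g m) * ∏ j ∈ Finset.range m, g (j + 1) := by
    rw [Finset.prod_mul_distrib, ← Finset.prod_range_succ]
    conv_lhs => rw [Finset.prod_range_succ' _ m, hg0, mul_one]
    rw [Finset.prod_range_succ', hg0, mul_one]
  rw [Finset.prod_div_distrib, h1, h2, Finset.prod_div_distrib, Finset.prod_mul_distrib,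
    Finset.prod_mul_distrib, Finset.prod_mul_distrib, Finset.prod_const, Finset.card_range] at h
  rw [Finset.prod_div_distrib, Finset.prod_range_succ', Finset.prod_const, Finset.card_range,
    pow_succ]
  have hu := hg 1
  have hgm := hg m
  field_simp at h ⊢
  simpa only [zero_add, add_assoc, one_add_one_eq_two, mul_comm] using h

theorem selberg_eq_prod (k n : ℕ) : ∀ a b : ℝ, 0 < a → 0 < b →
    selberg n k a b = ∏ j ∈ Finset.range n, (Real.Gamma (a + (j * k : ℕ)) *
      Real.Gamma (b + (j * k : ℕ)) * Real.Gamma (1 + ((j + 1) * k : ℕ)) /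
      (Real.Gamma (a + b + ((n - 1 + j) * k : ℕ)) * Real.Gamma (1 + (1 * k : ℕ)))) := by
  induction n with
  | zero =>
    intro a b _ _
    simp [selberg, vandermonde, Measure.real, Set.pi_univ_Icc, Real.volume_Icc_pi]
  | succ m ih =>
    intro a b ha hb
    obtain ⟨c, hc⟩ := exists_const_selberg m k
    simp only [fun a b : ℝ => Fin.prod_univ_eq_prod_range (fun j : ℕ => Real.Gamma (a + (j * k : ℕ)) *
      Real.Gamma (b + (j * k : ℕ)) / Real.Gamma (a + b + ((m + j) * k : ℕ))) (m + 1)] at hc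
    have hrec := selberg_one_one_succ m k
    rw [hc 1 1 one_pos one_pos, ih 1 _ one_pos (by positivity)] at hrec
    have hcval := eq_prod_of_mul_prod_eq (g := fun i => Real.Gamma (1 + (i * k : ℕ)))
      (D := fun i => Real.Gamma (1 + 1 + (i * k : ℕ))) (c := c) (t := 1 + (m * k : ℕ)) (m := m)
      (fun i => (Real.Gamma_pos_of_pos (by positivity)).ne')
      (fun i => (Real.Gamma_pos_of_pos (by positivity)).ne') (by simp)
      (by rw [add_assoc, add_comm, Real.Gamma_add_one (by positivity)])
      (hrec.trans (Finset.prod_congr rfl fun j hj => by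
        have hj := Finset.mem_range.1 hj
        have h1 : m + 1 + j = m - 1 + j + 2 := by omega
        rw [h1]
        push_cast
        ring_nf))
    rw [hc a b ha hb, hcval, ← Finset.prod_mul_distrib]
    refine Finset.prod_congr rfl fun j _ => ?_
    rw [div_mul_div_comm, Nat.add_sub_cancel]
    congr 1 <;> ring

/-- Selberg's integral formula for integer exponent. -/
theorem selberg_integral_formula (n k : ℕ) (hn : 1 ≤ n) (hk : 1 ≤ k)
    (a b : ℝ) (ha : 0 < a) (hb : 0 < b) :
    selberg n k a b =
      ∏ j ∈ Finset.range n,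
        Real.Gamma (a + j * k) * Real.Gamma (b + j * k) *
          Real.Gamma ((j + 1) * k + 1) /
          (Real.Gamma (a + b + ((n : ℝ) + j - 1) * k) * Real.Gamma (k + 1)) := by
  rw [selberg_eq_prod k n a b ha hb]
  refine Finset.prod_congr rfl fun j _ => ?_
  have h : (((n - 1 + j) * k : ℕ) : ℝ) = ((n : ℝ) + j - 1) * k := by
    push_cast [Nat.cast_sub hn]
    ring
  rw [h, one_mul, add_comm (1 : ℝ), add_comm (1 : ℝ)]
  push_cast
  rfl
end

section
/- Symmetry relating the Hankel and symmetric forms of the Selberg hypermatrix: Let n ≥ 1 and k ≥ 1 be integers and a, b > 0 real. Let S be the hypermatrix of order 2k and dimension n with entries S(i₁,…,i_{2k}) = B(a + i₁+⋯+i_{2k}, b), and let S^Sym be the hypermatrix of order 2k and dimension n with entries S^Sym(i₁,…,i_{2k}) = B(a + i₁+⋯+i_k, b + i_{k+1}+⋯+i_{2k}), all indices in {0,…,n−1}. Then Det(S^Sym) = (−1)^{k n (n−1)/2} · Det(S). -/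
open Nat

/-- The Euler Beta function `B(a,b) = ∫₀¹ x^{a-1} (1-x)^{b-1} dx`. -/
noncomputable def betaFn (a b : ℝ) : ℝ :=
  ∫ x in (0:ℝ)..1, x ^ (a - 1) * (1 - x) ^ (b - 1)

/-- The hyperdeterminant of a hypermatrix of order `m` and dimension `n`. -/
noncomputable def hypDet {m n : ℕ} (M : (Fin m → Fin n) → ℝ) : ℝ :=
  (1 / (n ! : ℝ)) * ∑ σ : Fin m → Equiv.Perm (Fin n),
    (∏ s, ((Equiv.Perm.sign (σ s) : ℤ) : ℝ)) * ∏ i, M fun s => σ s i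

/-- The sum over permutations in `hypDet`, expanded after a linear change of each index. -/
lemma sum_perm_linear_action {m n : ℕ} (P : Fin m → Matrix (Fin n) (Fin n) ℝ)
    (M : (Fin m → Fin n) → ℝ) :
    ∑ σ : Fin m → Equiv.Perm (Fin n), (∏ s, ((Equiv.Perm.sign (σ s) : ℤ) : ℝ)) *
        ∏ i, ∑ u : Fin m → Fin n, (∏ s, P s (σ s i) (u s)) * M u =
      ∑ U : Fin n → Fin m → Fin n,
        (∏ s, ((P s).submatrix id fun i => U i s).det) * ∏ i, M (U i) := by
  simp_rw [Finset.prod_univ_sum, Fintype.piFinset_univ, Finset.mul_sum]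
  rw [Finset.sum_comm]
  refine Finset.sum_congr rfl fun U _ => ?_
  simp_rw [Matrix.det_apply', Finset.prod_univ_sum, Fintype.piFinset_univ, Finset.sum_mul]
  refine Finset.sum_congr rfl fun σ _ => ?_
  rw [Finset.prod_mul_distrib, Finset.prod_mul_distrib, Finset.prod_comm, mul_assoc]
  rfl

/-- A linear change of each index multiplies the hyperdeterminant by the determinants. -/
lemma hypDet_linear_action {m n : ℕ} (P : Fin m → Matrix (Fin n) (Fin n) ℝ)
    (M : (Fin m → Fin n) → ℝ) :
    hypDet (fun t => ∑ u : Fin m → Fin n, (∏ s, P s (t s) (u s)) * M u) =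
      (∏ s, (P s).det) * hypDet M := by
  have h1 : ∀ t, ∑ u : Fin m → Fin n,
      (∏ s, (1 : Matrix (Fin n) (Fin n) ℝ) (t s) (u s)) * M u = M t := by
    intro t
    rw [Finset.sum_eq_single t]
    · simp
    · intro u _ hu
      obtain ⟨s, hs⟩ := Function.ne_iff.mp hu
      have h0 : (1 : Matrix (Fin n) (Fin n) ℝ) (t s) (u s) = 0 := Matrix.one_apply_ne hs.symm
      exact mul_eq_zero_of_left (Finset.prod_eq_zero (Finset.mem_univ s) h0) _
    · simp
  have h2 := sum_perm_linear_action (fun _ : Fin m => (1 : Matrix (Fin n) (Fin n) ℝ)) M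
  simp_rw [h1] at h2
  unfold hypDet
  rw [sum_perm_linear_action, h2, mul_left_comm, Finset.mul_sum (a := ∏ s, (P s).det)]
  congr 1
  refine Finset.sum_congr rfl fun U _ => ?_
  rw [← mul_assoc, ← Finset.prod_mul_distrib]
  congr 1
  refine Finset.prod_congr rfl fun s _ => ?_
  rw [← Matrix.det_mul]
  congr 1
  ext i j
  simp [Matrix.mul_apply, Matrix.one_apply]

/-- The coefficients of `(1 - x) ^ j` in the monomial basis. -/
def oneSubPowMatrix (n : ℕ) : Matrix (Fin n) (Fin n) ℝ :=
  Matrix.of fun j m => (-1) ^ (m : ℕ) * ((j : ℕ).choose m : ℝ)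

lemma det_oneSubPowMatrix (n : ℕ) : (oneSubPowMatrix n).det = (-1) ^ (n * (n - 1) / 2) := by
  rw [Matrix.det_of_isLowerTriangular]
  · simp only [oneSubPowMatrix, Matrix.of_apply, Nat.choose_self, Nat.cast_one, mul_one]
    rw [Fin.prod_univ_eq_prod_range (fun i => (-1 : ℝ) ^ i), Finset.prod_pow_eq_pow_sum,
      Finset.sum_range_id]
  · intro i j hij
    have h : (i : ℕ) < j := hij
    simp [oneSubPowMatrix, Nat.choose_eq_zero_of_lt h]

lemma one_sub_pow_eq_sum {n : ℕ} (j : Fin n) (x : ℝ) :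
    (1 - x) ^ (j : ℕ) = ∑ m : Fin n, oneSubPowMatrix n j m * x ^ (m : ℕ) := by
  simp only [oneSubPowMatrix, Matrix.of_apply]
  rw [Fin.sum_univ_eq_sum_range (fun m => (-1 : ℝ) ^ m * ((j : ℕ).choose m : ℝ) * x ^ m),
    sub_eq_neg_add, add_pow]
  refine Finset.sum_subset_zero_on_sdiff (Finset.range_subset_range.mpr j.isLt) ?_ ?_
  · intro m hm
    simp only [Finset.mem_sdiff, Finset.mem_range, not_lt] at hm
    rw [Nat.choose_eq_zero_of_lt (by omega)]
    simp
  · intro m _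
    rw [neg_pow]
    ring

lemma intervalIntegrable_beta {a b : ℝ} (ha : 0 < a) (hb : 0 < b) :
    IntervalIntegrable (fun x : ℝ => x ^ (a - 1) * (1 - x) ^ (b - 1))
      MeasureTheory.volume 0 1 := by
  have h := Complex.betaIntegral_convergent (u := a) (v := b) (by simpa) (by simpa)
  rw [intervalIntegrable_iff_integrableOn_Ioo_of_le zero_le_one] at h ⊢
  refine MeasureTheory.IntegrableOn.congr_fun h.re ?_ measurableSet_Ioo
  intro x hx
  have h1 : (0 : ℝ) ≤ 1 - x := by linarith [hx.2]
  have e : ((x : ℂ) ^ ((a : ℂ) - 1) * (1 - (x : ℂ)) ^ ((b : ℂ) - 1)) =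
      ((x ^ (a - 1) * (1 - x) ^ (b - 1) : ℝ) : ℂ) := by
    rw [Complex.ofReal_mul, Complex.ofReal_cpow hx.1.le, Complex.ofReal_cpow h1]
    push_cast
    rfl
  simp only [e]
  exact Complex.ofReal_re _

lemma betaFn_add_natCast {a b : ℝ} (p q : ℕ) :
    betaFn (a + p) (b + q) =
      ∫ x in (0:ℝ)..1, x ^ (a - 1) * (1 - x) ^ (b - 1) * (x ^ p * (1 - x) ^ q) := by
  unfold betaFn
  refine intervalIntegral.integral_congr_Ioo_of_le zero_le_one fun x hx => ?_
  have h1 : (0 : ℝ) < 1 - x := by linarith [hx.2]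
  rw [add_sub_right_comm, add_sub_right_comm, Real.rpow_add_natCast hx.1.ne',
    Real.rpow_add_natCast h1.ne']
  ring

lemma betaFn_eq_sum {m n : ℕ} (p : Fin m → Prop) [DecidablePred p] {a b : ℝ}
    (ha : 0 < a) (hb : 0 < b) (t : Fin m → Fin n) :
    betaFn (a + (∑ s with p s, (t s : ℕ) : ℕ)) (b + (∑ s with ¬ p s, (t s : ℕ) : ℕ)) =
      ∑ u : Fin m → Fin n,
        (∏ s, (if p s then 1 else oneSubPowMatrix n : Matrix (Fin n) (Fin n) ℝ) (t s) (u s)) *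
          betaFn (a + (∑ s, (u s : ℕ) : ℕ)) b := by
  have hu : ∀ u : Fin m → Fin n, betaFn (a + (∑ s, (u s : ℕ) : ℕ)) b =
      ∫ x in (0:ℝ)..1, x ^ (a - 1) * (1 - x) ^ (b - 1) * x ^ (∑ s, (u s : ℕ)) := by
    intro u
    simpa using betaFn_add_natCast (a := a) (b := b) (∑ s, (u s : ℕ)) 0
  simp_rw [hu, betaFn_add_natCast, ← intervalIntegral.integral_const_mul]
  rw [← intervalIntegral.integral_finsetSum]
  · congr 1
    ext x
    have key : x ^ (∑ s with p s, (t s : ℕ)) * (1 - x) ^ (∑ s with ¬ p s, (t s : ℕ)) =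
        ∏ s, ∑ j : Fin n, (if p s then 1 else oneSubPowMatrix n : Matrix (Fin n) (Fin n) ℝ)
          (t s) j * x ^ (j : ℕ) := by
      rw [← Finset.prod_pow_eq_pow_sum, ← Finset.prod_pow_eq_pow_sum, ← Finset.prod_ite]
      refine Finset.prod_congr rfl fun s _ => ?_
      split_ifs with h
      · simp [Matrix.one_apply]
      · exact one_sub_pow_eq_sum _ _
    rw [key, Finset.prod_univ_sum, Fintype.piFinset_univ, Finset.mul_sum]
    refine Finset.sum_congr rfl fun u _ => ?_
    rw [Finset.prod_mul_distrib, Finset.prod_pow_eq_pow_sum]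
    ring
  · intro u _
    exact ((intervalIntegrable_beta ha hb).mul_continuousOn (by fun_prop)).const_mul _

/-- Symmetry relating the Hankel and symmetric forms of the Selberg hypermatrix:
`Det(B(a + i₁+⋯+i_k, b + i_{k+1}+⋯+i_{2k})) = (-1)^{kn(n-1)/2} Det(B(a + i₁+⋯+i_{2k}, b))`. -/
theorem selberg_symmetric_form (n k : ℕ) (hn : 1 ≤ n) (hk : 1 ≤ k)
    (a b : ℝ) (ha : 0 < a) (hb : 0 < b) :
    hypDet (fun t : Fin (2 * k) → Fin n =>
        betaFn (a + ∑ s ∈ Finset.univ.filter (fun s : Fin (2 * k) => (s : ℕ) < k), (t s : ℕ))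
               (b + ∑ s ∈ Finset.univ.filter (fun s : Fin (2 * k) => k ≤ (s : ℕ)), (t s : ℕ))) =
      (-1 : ℝ) ^ (k * n * (n - 1) / 2) *
        hypDet (fun t : Fin (2 * k) → Fin n => betaFn (a + ∑ s, (t s : ℕ)) b) := by
  have hentry := betaFn_eq_sum (n := n) (fun s : Fin (2 * k) => (s : ℕ) < k) ha hb
  simp only [not_lt] at hentry
  simp_rw [hentry]
  rw [hypDet_linear_action]
  congr 1
  have hcard : (Finset.univ.filter fun s : Fin (2 * k) => ¬ (s : ℕ) < k).card = k := by
    have h1 := Finset.card_filter_add_card_filter_not (s := (Finset.univ : Finset (Fin (2 * k))))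
      (fun s => (s : ℕ) < k)
    rw [Fin.card_filter_val_lt, Finset.card_univ, Fintype.card_fin] at h1
    omega
  simp_rw [apply_ite Matrix.det, Matrix.det_one, det_oneSubPowMatrix]
  rw [Finset.prod_ite, Finset.prod_const_one, one_mul, Finset.prod_const, hcard, ← pow_mul,
    mul_assoc k, Nat.mul_div_assoc k (Nat.even_mul_pred_self n).two_dvd, mul_comm k]
end
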